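/- The map ε ↦ ĝ_ε(X;Y)/ε is non-increasing on (0,∞): for 0 < ε' ≤ ε, ĝ_{ε'}(X;Y)/ε' ≥ ĝ_ε(X;Y)/ε. -/

import Mathlib

open scoped BigOperators

noncomputable section

namespace RatePrivacy

variable {α β γ : Type*}

/-- `p` is a probability mass function on a finite alphabet. -/
def IsPMF [Fintype α] (p : α → ℝ) : Prop := (∀ a, 0 ≤ p a) ∧ ∑ a, p a = 1

/-- Shannon entropy (in bits) of the distribution `p`. -/
def ent [Fintype α] (p : α → ℝ) : ℝ := ∑ a, -(p a * Real.logb 2 (p a))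

/-- First marginal of a joint distribution. -/
def margA [Fintype α] [Fintype β] (p : α × β → ℝ) : α → ℝ := fun a => ∑ b, p (a, b)

/-- Second marginal of a joint distribution. -/
def margB [Fintype α] [Fintype β] (p : α × β → ℝ) : β → ℝ := fun b => ∑ a, p (a, b)

/-- Mutual information (in bits) of a joint distribution `p`:
`I(A;B) = H(A) + H(B) - H(A,B)`. -/
def mi [Fintype α] [Fintype β] (p : α × β → ℝ) : ℝ :=
  ent (margA p) + ent (margB p) - ent p

/-- `q` is a (row-stochastic) channel. -/
def IsChannel [Fintype γ] (q : β → γ → ℝ) : Prop :=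
  (∀ y z, 0 ≤ q y z) ∧ ∀ y, ∑ z, q y z = 1

/-- Joint distribution of `(X, Z)` when `Z` is obtained from `Y` through the channel `q`
(so that `X — Y — Z` is a Markov chain). -/
def jointXZ [Fintype α] [Fintype β] [Fintype γ] (p : α × β → ℝ) (q : β → γ → ℝ) :
    α × γ → ℝ := fun xz => ∑ y, p (xz.1, y) * q y xz.2

/-- Joint distribution of `(Y, Z)` when `Z` is obtained from `Y` through the channel `q`. -/
def jointYZ [Fintype α] [Fintype β] [Fintype γ] (p : α × β → ℝ) (q : β → γ → ℝ) :
    β × γ → ℝ := fun yz => margB p yz.1 * q yz.1 yz.2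

/-- Achievable rates `I(Y;Z)` over all privacy filters `Z` (on finite alphabets, wlog `Fin n`)
with `X — Y — Z` Markov and `I(X;Z) ≤ ε`. -/
def gSet [Fintype α] [Fintype β] (p : α × β → ℝ) (ε : ℝ) : Set ℝ :=
  { r | ∃ (n : ℕ) (q : β → Fin n → ℝ), IsChannel q ∧
        mi (jointXZ p q) ≤ ε ∧ r = mi (jointYZ p q) }

/-- The rate-privacy function `g_ε(X;Y)` (privacy measured by mutual information). -/
def g [Fintype α] [Fintype β] (p : α × β → ℝ) (ε : ℝ) : ℝ := sSup (gSet p ε)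

/-- Values `E[f(A) g(B)]` over all zero-mean unit-variance `f, g`, used to define
the Hirschfeld–Gebelein–Rényi maximal correlation. -/
def corrSet [Fintype α] [Fintype β] (p : α × β → ℝ) : Set ℝ :=
  { r | ∃ (f : α → ℝ) (g : β → ℝ),
      (∑ a, margA p a * f a = 0) ∧ (∑ b, margB p b * g b = 0) ∧
      (∑ a, margA p a * (f a) ^ 2 = 1) ∧ (∑ b, margB p b * (g b) ^ 2 = 1) ∧
      r = ∑ x : α × β, p x * (f x.1 * g x.2) }

/-- Maximal correlation `ρ_m(A;B)` (equal to `0` when the constraint set is empty,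
since `sSup ∅ = 0` in `ℝ`). -/
def rhoM [Fintype α] [Fintype β] (p : α × β → ℝ) : ℝ := sSup (corrSet p)

/-- Achievable rates with maximal-correlation privacy constraint `ρ_m²(X;Z) ≤ ε`. -/
def ghSet [Fintype α] [Fintype β] (p : α × β → ℝ) (ε : ℝ) : Set ℝ :=
  { r | ∃ (n : ℕ) (q : β → Fin n → ℝ), IsChannel q ∧
        (rhoM (jointXZ p q)) ^ 2 ≤ ε ∧ r = mi (jointYZ p q) }

/-- The rate-privacy function `ĝ_ε(X;Y)` (privacy measured by squared maximal correlation). -/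
def gh [Fintype α] [Fintype β] (p : α × β → ℝ) (ε : ℝ) : ℝ := sSup (ghSet p ε)

/-- The Kullback–Leibler divergence (in bits) `D(P_{X|Y}(·|y) ‖ P_X)`. -/
def Dxy [Fintype α] [Fintype β] (p : α × β → ℝ) (y : β) : ℝ :=
  ∑ x, (p (x, y) / margB p y) * Real.logb 2 ((p (x, y) / margB p y) / margA p x)

lemma ent_eq_negMulLog [Fintype α] (p : α → ℝ) :
    ent p = (∑ a, Real.negMulLog (p a)) / Real.log 2 := by
  simp only [ent, Real.negMulLog, Real.logb, Finset.sum_div]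
  exact Finset.sum_congr rfl fun a _ => by ring

lemma ent_const_mul [Fintype α] (c : ℝ) (p : α → ℝ) :
    ent (fun a => c * p a) = c * ent p + (∑ a, p a) * (Real.negMulLog c / Real.log 2) := by
  simp only [ent_eq_negMulLog, Real.negMulLog_mul, Finset.sum_add_distrib, ← Finset.mul_sum,
    ← Finset.sum_mul]
  ring

lemma sum_margA [Fintype α] [Fintype β] (p : α × β → ℝ) :
    ∑ a, margA p a = ∑ x, p x := (Fintype.sum_prod_type p).symm

lemma sum_margB [Fintype α] [Fintype β] (p : α × β → ℝ) :
    ∑ b, margB p b = ∑ x, p x := (Fintype.sum_prod_type_right p).symm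

lemma sum_mul_fst [Fintype α] [Fintype β] (p : α × β → ℝ) (f : α → ℝ) :
    ∑ x, p x * f x.1 = ∑ a, margA p a * f a := by
  simp [Fintype.sum_prod_type, margA, Finset.sum_mul]

lemma sum_mul_snd [Fintype α] [Fintype β] (p : α × β → ℝ) (g : β → ℝ) :
    ∑ x, p x * g x.2 = ∑ b, margB p b * g b := by
  simp [Fintype.sum_prod_type_right, margB, Finset.sum_mul]

lemma mi_le_ent_margA [Fintype α] [Fintype β] {p : α × β → ℝ} (hp : IsPMF p) :
    mi p ≤ ent (margA p) := by
  suffices h : ent (margB p) ≤ ent p by unfold mi; linarith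
  have hB : ent (margB p) = ∑ x, -(p x * Real.logb 2 (margB p x.2)) := by
    simp_rw [ent, ← mul_neg]
    exact (sum_mul_snd p fun b => -Real.logb 2 (margB p b)).symm
  rw [hB, ent]
  refine Finset.sum_le_sum fun x _ => ?_
  rcases (hp.1 x).eq_or_lt with h | h
  · simp [← h]
  · have hle : p x ≤ margB p x.2 :=
      Finset.single_le_sum (f := fun a => p (a, x.2)) (fun a _ => hp.1 _) (Finset.mem_univ x.1)
    have := Real.logb_le_logb_of_le one_lt_two h hle
    nlinarith

lemma sq_sum_mul_le [Fintype α] [Fintype β] {p : α × β → ℝ} (hp : IsPMF p)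
    (f : α → ℝ) (g : β → ℝ) :
    (∑ x : α × β, p x * (f x.1 * g x.2)) ^ 2 ≤
      (∑ a, margA p a * f a ^ 2) * ∑ b, margB p b * g b ^ 2 := by
  rw [← sum_mul_fst p fun a => f a ^ 2, ← sum_mul_snd p fun b => g b ^ 2]
  exact Finset.sum_sq_le_sum_mul_sum_of_sq_le_mul _
    (fun x _ => mul_nonneg (hp.1 x) (sq_nonneg _)) (fun x _ => mul_nonneg (hp.1 x) (sq_nonneg _))
    fun x _ => le_of_eq (by ring)

lemma bddAbove_corrSet [Fintype α] [Fintype β] {p : α × β → ℝ} (hp : IsPMF p) :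
    BddAbove (corrSet p) := by
  refine ⟨1, ?_⟩
  rintro r ⟨f, g, -, -, hf, hg, rfl⟩
  have h := sq_sum_mul_le hp f g
  rw [hf, hg] at h
  nlinarith

lemma rhoM_nonneg [Fintype α] [Fintype β] {p : α × β → ℝ} (hp : IsPMF p) : 0 ≤ rhoM p := by
  rcases (corrSet p).eq_empty_or_nonempty with h | ⟨r, f, g, hf, hg, hf2, hg2, hr⟩
  · simp [rhoM, h]
  · have h1 : r ≤ rhoM p := le_csSup (bddAbove_corrSet hp) ⟨f, g, hf, hg, hf2, hg2, hr⟩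
    have h2 : -r ≤ rhoM p := by
      refine le_csSup (bddAbove_corrSet hp) ⟨fun a => -f a, g, ?_, hg, ?_, hg2, ?_⟩
      · simp [hf]
      · simpa using hf2
      · simp [hr]
    linarith

/-- The maximal correlation bounds the covariance even when `g` is not normalised. -/
lemma sum_mul_le_sqrt_mul_rhoM [Fintype α] [Fintype β] {p : α × β → ℝ} (hp : IsPMF p)
    {f : α → ℝ} (hf : ∑ a, margA p a * f a = 0) (hf2 : ∑ a, margA p a * f a ^ 2 = 1)
    (g : β → ℝ) :
    ∑ x : α × β, p x * (f x.1 * g x.2) ≤ √(∑ b, margB p b * g b ^ 2) * rhoM p := by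
  set m := ∑ b, margB p b * g b with hm
  set v := ∑ b, margB p b * (g b - m) ^ 2 with hv
  have hB : ∑ b, margB p b = 1 := (sum_margB p).trans hp.2
  have hvar : v = (∑ b, margB p b * g b ^ 2) - m ^ 2 := by
    have : ∀ b, margB p b * (g b - m) ^ 2 =
        margB p b * g b ^ 2 - 2 * m * (margB p b * g b) + m ^ 2 * margB p b := fun b => by ring
    simp_rw [hv, this, Finset.sum_add_distrib, Finset.sum_sub_distrib, ← Finset.mul_sum, hB, ← hm]
    ring
  have hcov : ∑ x : α × β, p x * (f x.1 * g x.2) = ∑ x : α × β, p x * (f x.1 * (g x.2 - m)) := by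
    have : ∀ x : α × β, p x * (f x.1 * (g x.2 - m)) =
        p x * (f x.1 * g x.2) - m * (p x * f x.1) := fun x => by ring
    simp_rw [this, Finset.sum_sub_distrib, ← Finset.mul_sum, sum_mul_fst, hf]
    ring
  have hv0 : 0 ≤ v := Finset.sum_nonneg fun b _ =>
    mul_nonneg (Finset.sum_nonneg fun a _ => hp.1 _) (sq_nonneg _)
  have hρ := rhoM_nonneg hp
  rcases hv0.eq_or_lt with h0 | hpos
  · have h := sq_sum_mul_le hp f fun b => g b - m
    rw [← hv, ← h0, mul_zero, ← hcov] at h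
    rw [pow_eq_zero_iff two_ne_zero |>.1 (le_antisymm h (sq_nonneg _))]
    positivity
  · have hs : 0 < √v := Real.sqrt_pos.2 hpos
    have hmem : (∑ x : α × β, p x * (f x.1 * g x.2)) / √v ∈ corrSet p := by
      refine ⟨f, fun b => (g b - m) / √v, hf, ?_, hf2, ?_, ?_⟩
      · simp_rw [← mul_div_assoc, ← Finset.sum_div, mul_sub, Finset.sum_sub_distrib,
          ← Finset.sum_mul, hB, ← hm]
        simp
      · simp_rw [div_pow, Real.sq_sqrt hv0, ← mul_div_assoc, ← Finset.sum_div, ← hv]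
        exact div_self hpos.ne'
      · simp_rw [hcov, ← mul_div_assoc, ← Finset.sum_div]
    have h := (div_le_iff₀' hs).1 (le_csSup (bddAbove_corrSet hp) hmem)
    exact h.trans (mul_le_mul_of_nonneg_right
      (Real.sqrt_le_sqrt (by rw [hvar]; linarith [sq_nonneg m])) hρ)

/-- The channel that outputs the symbol of `q` with probability `c` and the erasure symbol `0`
with probability `1 - c`. -/
def eraseChannel {n : ℕ} (c : ℝ) (q : β → Fin n → ℝ) : β → Fin (n + 1) → ℝ :=
  fun y => Fin.cons (1 - c) fun z => c * q y z

/-- The joint distribution of `(A, Z')`, where `Z'` is `Z` with probability `c` and the erasure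
symbol `0` with probability `1 - c`, independently of `(A, Z)`. -/
def eraseJoint [Fintype α] {n : ℕ} (c : ℝ) (p : α × Fin n → ℝ) : α × Fin (n + 1) → ℝ :=
  fun x => (Fin.cons ((1 - c) * margA p x.1) fun z => c * p (x.1, z) : Fin (n + 1) → ℝ) x.2

lemma isChannel_eraseChannel {n : ℕ} {c : ℝ} (h0 : 0 ≤ c) (h1 : c ≤ 1) {q : β → Fin n → ℝ}
    (hq : IsChannel q) : IsChannel (eraseChannel c q) := by
  refine ⟨fun y z => ?_, fun y => ?_⟩
  · cases z using Fin.cases with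
    | zero => simpa [eraseChannel] using h1
    | succ z => simpa [eraseChannel] using mul_nonneg h0 (hq.1 y z)
  · simp [eraseChannel, Fin.sum_univ_succ, ← Finset.mul_sum, hq.2 y]

lemma margA_jointXZ [Fintype α] [Fintype β] [Fintype γ] (p : α × β → ℝ) {q : β → γ → ℝ}
    (hq : IsChannel q) : margA (jointXZ p q) = margA p := by
  funext a
  simp only [margA, jointXZ]
  rw [Finset.sum_comm]
  simp [← Finset.mul_sum, hq.2]

lemma margA_jointYZ [Fintype α] [Fintype β] [Fintype γ] (p : α × β → ℝ) {q : β → γ → ℝ}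
    (hq : IsChannel q) : margA (jointYZ p q) = margB p := by
  funext b
  simp [margA, jointYZ, ← Finset.mul_sum, hq.2]

lemma isPMF_jointXZ [Fintype α] [Fintype β] [Fintype γ] {p : α × β → ℝ} (hp : IsPMF p)
    {q : β → γ → ℝ} (hq : IsChannel q) : IsPMF (jointXZ p q) :=
  ⟨fun _ => Finset.sum_nonneg fun _ _ => mul_nonneg (hp.1 _) (hq.1 _ _),
    by rw [← sum_margA, margA_jointXZ p hq, sum_margA, hp.2]⟩

lemma isPMF_jointYZ [Fintype α] [Fintype β] [Fintype γ] {p : α × β → ℝ} (hp : IsPMF p)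
    {q : β → γ → ℝ} (hq : IsChannel q) : IsPMF (jointYZ p q) :=
  ⟨fun _ => mul_nonneg (Finset.sum_nonneg fun _ _ => hp.1 _) (hq.1 _ _),
    by rw [← sum_margA, margA_jointYZ p hq, sum_margB, hp.2]⟩

lemma jointXZ_eraseChannel [Fintype α] [Fintype β] {n : ℕ} (c : ℝ) (p : α × β → ℝ)
    {q : β → Fin n → ℝ} (hq : IsChannel q) :
    jointXZ p (eraseChannel c q) = eraseJoint c (jointXZ p q) := by
  funext ⟨a, z⟩
  simp only [eraseJoint, margA_jointXZ p hq]
  cases z using Fin.cases with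
  | zero => simp [jointXZ, eraseChannel, margA, Finset.mul_sum, mul_comm]
  | succ z => simp [jointXZ, eraseChannel, Finset.mul_sum, mul_left_comm]

lemma jointYZ_eraseChannel [Fintype α] [Fintype β] {n : ℕ} (c : ℝ) (p : α × β → ℝ)
    {q : β → Fin n → ℝ} (hq : IsChannel q) :
    jointYZ p (eraseChannel c q) = eraseJoint c (jointYZ p q) := by
  funext ⟨b, z⟩
  simp only [eraseJoint, margA_jointYZ p hq]
  cases z using Fin.cases with
  | zero => simp [jointYZ, eraseChannel, mul_comm]
  | succ z => simp [jointYZ, eraseChannel, mul_left_comm]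

section Erasure

variable [Fintype α] {n : ℕ}

lemma margA_eraseJoint (c : ℝ) (p : α × Fin n → ℝ) : margA (eraseJoint c p) = margA p := by
  funext a
  have h : margA (eraseJoint c p) a = (1 - c) * margA p a + c * margA p a := by
    rw [margA, Fin.sum_univ_succ]
    simp [eraseJoint, margA, Finset.mul_sum]
  rw [h]; ring

lemma margB_eraseJoint (c : ℝ) {p : α × Fin n → ℝ} (hp : IsPMF p) :
    margB (eraseJoint c p) = Fin.cons (1 - c) fun z => c * margB p z := by
  funext z
  cases z using Fin.cases with
  | zero => simp [margB, eraseJoint, ← Finset.mul_sum, sum_margA, hp.2]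
  | succ z => simp [margB, eraseJoint, Finset.mul_sum]

lemma mi_eraseJoint (c : ℝ) {p : α × Fin n → ℝ} (hp : IsPMF p) :
    mi (eraseJoint c p) = c * mi p := by
  have hB : ent (margB (eraseJoint c p)) =
      Real.negMulLog (1 - c) / Real.log 2 + ent fun z => c * margB p z := by
    rw [margB_eraseJoint c hp]
    simp [ent_eq_negMulLog, Fin.sum_univ_succ, add_div]
  have hJ : ent (eraseJoint c p) = ent (fun a => (1 - c) * margA p a) + ent fun x => c * p x := by
    simp [ent_eq_negMulLog, Fintype.sum_prod_type, Fin.sum_univ_succ, eraseJoint,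
      Finset.sum_add_distrib, add_div]
  rw [mi, mi, margA_eraseJoint, hB, hJ]
  simp only [ent_const_mul, sum_margA, sum_margB, hp.2]
  ring

lemma rhoM_eraseJoint_le {c : ℝ} (h0 : 0 ≤ c) (h1 : c ≤ 1) {p : α × Fin n → ℝ} (hp : IsPMF p) :
    rhoM (eraseJoint c p) ≤ √c * rhoM p := by
  have hρ := rhoM_nonneg hp
  refine Real.sSup_le ?_ (by positivity)
  rintro r ⟨f, g, hf, -, hf2, hg2, rfl⟩
  rw [margA_eraseJoint] at hf hf2
  set w := ∑ z, margB p z * g z.succ ^ 2 with hw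
  have hcw : c * w ≤ 1 := by
    rw [margB_eraseJoint c hp, Fin.sum_univ_succ] at hg2
    simp only [Fin.cons_zero, Fin.cons_succ, mul_assoc, ← Finset.mul_sum, ← hw] at hg2
    nlinarith [mul_nonneg (sub_nonneg.2 h1) (sq_nonneg (g 0))]
  have hcov : ∑ x : α × Fin (n + 1), eraseJoint c p x * (f x.1 * g x.2) =
      c * ∑ x : α × Fin n, p x * (f x.1 * g x.2.succ) := by
    have h : ∑ a, (1 - c) * (margA p a * (f a * g 0)) = 0 := by
      rw [← mul_zero ((1 - c) * g 0), ← hf, Finset.mul_sum]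
      exact Finset.sum_congr rfl fun a _ => by ring
    simp only [Fintype.sum_prod_type, Fin.sum_univ_succ, eraseJoint, Fin.cons_zero, Fin.cons_succ,
      Finset.sum_add_distrib, h, zero_add, Finset.mul_sum, mul_assoc]
  have hsqrt : c * √w ≤ √c := by
    calc c * √w = √c * (√c * √w) := by rw [← mul_assoc, Real.mul_self_sqrt h0]
      _ = √c * √(c * w) := by rw [Real.sqrt_mul h0]
      _ ≤ √c := mul_le_of_le_one_right (Real.sqrt_nonneg _) (Real.sqrt_le_one.2 hcw)
  calc ∑ x : α × Fin (n + 1), eraseJoint c p x * (f x.1 * g x.2)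
      ≤ c * (√w * rhoM p) := by
        rw [hcov]
        exact mul_le_mul_of_nonneg_left
          (sum_mul_le_sqrt_mul_rhoM hp hf hf2 fun z => g z.succ) h0
    _ ≤ √c * rhoM p := by
        rw [← mul_assoc]
        exact mul_le_mul_of_nonneg_right hsqrt hρ

end Erasure

lemma mul_mem_ghSet [Fintype α] [Fintype β] {p : α × β → ℝ} (hp : IsPMF p) {c ε r : ℝ}
    (h0 : 0 ≤ c) (h1 : c ≤ 1) (hr : r ∈ ghSet p ε) : c * r ∈ ghSet p (c * ε) := by
  obtain ⟨n, q, hq, hρ, rfl⟩ := hr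
  have hq' := isChannel_eraseChannel h0 h1 hq
  refine ⟨n + 1, eraseChannel c q, hq', ?_, ?_⟩
  · calc rhoM (jointXZ p (eraseChannel c q)) ^ 2 ≤ (√c * rhoM (jointXZ p q)) ^ 2 := by
          refine pow_le_pow_left₀ (rhoM_nonneg (isPMF_jointXZ hp hq')) ?_ 2
          rw [jointXZ_eraseChannel c p hq]
          exact rhoM_eraseJoint_le h0 h1 (isPMF_jointXZ hp hq)
      _ = c * rhoM (jointXZ p q) ^ 2 := by rw [mul_pow, Real.sq_sqrt h0]
      _ ≤ c * ε := mul_le_mul_of_nonneg_left hρ h0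
  · rw [jointYZ_eraseChannel c p hq, mi_eraseJoint c (isPMF_jointYZ hp hq)]

lemma bddAbove_ghSet [Fintype α] [Fintype β] {p : α × β → ℝ} (hp : IsPMF p) (ε : ℝ) :
    BddAbove (ghSet p ε) := by
  refine ⟨ent (margB p), ?_⟩
  rintro r ⟨n, q, hq, -, rfl⟩
  simpa [margA_jointYZ p hq] using mi_le_ent_margA (isPMF_jointYZ hp hq)

lemma corrSet_eq_empty [Fintype α] [Fintype γ] [Unique γ] {p : α × γ → ℝ} (hp : IsPMF p) :
    corrSet p = ∅ := by
  refine Set.eq_empty_of_forall_notMem ?_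
  rintro r ⟨f, g, -, hg, -, hg2, -⟩
  have hB : ∑ b, margB p b = 1 := (sum_margB p).trans hp.2
  simp only [Fintype.sum_unique] at hB hg hg2
  simp_all

lemma ghSet_nonempty [Fintype α] [Fintype β] {p : α × β → ℝ} (hp : IsPMF p) {ε : ℝ}
    (hε : 0 ≤ ε) : (ghSet p ε).Nonempty := by
  have hq : IsChannel (fun (_ : β) (_ : Fin 1) => (1 : ℝ)) := ⟨by simp, by simp⟩
  refine ⟨_, 1, _, hq, ?_, rfl⟩
  rw [rhoM, corrSet_eq_empty (isPMF_jointXZ hp hq)]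
  simpa using hε

/-- The map `ε ↦ ĝ_ε(X;Y)/ε` is non-increasing on `(0,∞)`:
for `0 < ε' ≤ ε`, `ĝ_{ε'}(X;Y)/ε' ≥ ĝ_ε(X;Y)/ε`. -/
theorem stmt2 {𝓧 𝓨 : Type*} [Fintype 𝓧] [Fintype 𝓨]
    (p : 𝓧 × 𝓨 → ℝ) (hp : IsPMF p) :
    ∀ ε' ε : ℝ, 0 < ε' → ε' ≤ ε → gh p ε / ε ≤ gh p ε' / ε' := by
  intro ε' ε hε' hle
  have hε : 0 < ε := hε'.trans_le hle
  rw [div_le_iff₀ hε]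
  refine csSup_le (ghSet_nonempty hp hε.le) fun r hr => ?_
  have h := le_csSup (bddAbove_ghSet hp _)
    (mul_mem_ghSet hp (div_pos hε' hε).le ((div_le_one hε).2 hle) hr)
  rw [div_mul_cancel₀ _ hε.ne'] at h
  calc r = ε' / ε * r / ε' * ε := by field_simp
    _ ≤ gh p ε' / ε' * ε := by
      have : ε' / ε * r ≤ gh p ε' := h
      gcongr

end RatePrivacy
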